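/- Gibbs representation theorem: every probability measure μ on Ω = E^S (E finite, S countable) that is quasilocal and uniformly non-null is a Gibbs measure; i.e. there exists a uniformly absolutely convergent potential Ψ with μ ∈ 𝒢(γ^Ψ). -/

import Mathlib

open MeasureTheory
open scoped ENNReal

/-- The concatenated configuration `σ_Λ ω_{Λᶜ}`. -/
noncomputable def extendIn {E S : Type*} [DecidableEq S] (Λ : Finset S)
    (σ : ↥Λ → E) (ω : S → E) : S → E :=
  fun i => if h : i ∈ Λ then σ ⟨i, h⟩ else ω i

/-- The Hamiltonian `H_Λ^Φ(ω) = Σ_{A ∩ Λ ≠ ∅} Φ_A(ω)` of the potential `Φ` in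
the finite volume `Λ` (so that `H_Λ^Φ(σ|ω) = H_Λ^Φ(σ_Λ ω_{Λᶜ})`). -/
noncomputable def hamWith {E S : Type*} [DecidableEq S]
    (Φ : Finset S → (S → E) → ℝ) (Λ : Finset S) (ω : S → E) : ℝ :=
  ∑' A : {A : Finset S // (A ∩ Λ).Nonempty}, Φ A.1 ω

/-- The Gibbs kernel at inverse temperature `β` acting on a function `g`:
`γ_Λ^{βΦ} g (ω) = Z_Λ^{βΦ}(ω)⁻¹ ∫ g(σ_Λ ω_{Λᶜ}) e^{-β H_Λ^Φ(σ|ω)} ρ_Λ(dσ_Λ)`,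
where `ρ_Λ` is the uniform a priori measure on `E^Λ` (its normalization cancels
against the partition function). -/
noncomputable def gibbsKernelFn {E S : Type*} [Fintype E] [DecidableEq S]
    (β : ℝ) (Φ : Finset S → (S → E) → ℝ) (Λ : Finset S)
    (g : (S → E) → ℝ) (ω : S → E) : ℝ :=
  (∑ σ : ↥Λ → E, g (extendIn Λ σ ω) *
      Real.exp (-β * hamWith Φ Λ (extendIn Λ σ ω))) /
    (∑ σ : ↥Λ → E, Real.exp (-β * hamWith Φ Λ (extendIn Λ σ ω)))

/-- The Gibbs kernel evaluated on a set: `γ_Λ^{βΦ}(A | ω)`. -/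
noncomputable def gibbsKernelSet {E S : Type*} [Fintype E] [DecidableEq S]
    (β : ℝ) (Φ : Finset S → (S → E) → ℝ) (Λ : Finset S)
    (A : Set (S → E)) (ω : S → E) : ℝ :=
  gibbsKernelFn β Φ Λ (A.indicator fun _ => (1 : ℝ)) ω

/-- A continuous function on a product of finite discrete spaces depends,
up to `ε`, on finitely many coordinates. -/
theorem exists_finset_abs_sub_lt_of_continuous {E S : Type*} [Finite E] [TopologicalSpace E]
    [DecidableEq S] {f : (S → E) → ℝ} (hf : Continuous f) {ε : ℝ} (hε : 0 < ε) :
    ∃ V : Finset S, ∀ η η' : S → E, (∀ i ∈ V, η i = η' i) → |f η - f η'| < ε := by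
  have hloc : ∀ ω : S → E, ∃ I : Finset S, ∃ u : S → Set E,
      (∀ i ∈ I, IsOpen (u i) ∧ ω i ∈ u i) ∧
        (I : Set S).pi u ⊆ f ⁻¹' Metric.ball (f ω) (ε / 2) := fun ω =>
    isOpen_pi_iff.1 (Metric.isOpen_ball.preimage hf) ω (by simp [hε])
  choose I u hu hsub using hloc
  obtain ⟨t, -, ht⟩ := isCompact_univ.elim_nhds_subcover (fun ω => (I ω : Set S).pi (u ω))
    fun ω _ => (isOpen_set_pi (I ω).finite_toSet fun i hi => (hu ω i hi).1).mem_nhds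
      fun i hi => (hu ω i hi).2
  refine ⟨t.biUnion I, fun η η' h => ?_⟩
  obtain ⟨ω, hωt, hω⟩ := Set.mem_iUnion₂.1 (ht (Set.mem_univ η))
  have hω' : η' ∈ (I ω : Set S).pi (u ω) := fun i hi => by
    rw [← h i (Finset.mem_biUnion.2 ⟨ω, hωt, hi⟩)]
    exact hω i hi
  have h1 := hsub ω hω
  have h2 := hsub ω hω'
  simp only [Set.mem_preimage, Metric.mem_ball, Real.dist_eq, abs_lt] at h1 h2
  rw [abs_lt]
  constructor <;> linarith [h1.1, h1.2, h2.1, h2.2]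

/-- A countable type is exhausted by finite sets growing at least as fast as prescribed. -/
theorem exists_finset_exhaustion {S : Type*} [DecidableEq S] [Countable S]
    (I : ℕ → Finset S → Finset S) :
    ∃ V : ℕ → Finset S, V 0 = ∅ ∧ Monotone V ∧ (∀ i, ∃ k, i ∈ V k) ∧
      ∀ k, I k (V k) ⊆ V (k + 1) := by
  have := Encodable.ofCountable S
  let V : ℕ → Finset S :=
    fun n => Nat.rec ∅ (fun k W => W ∪ (Encodable.decode (α := S) k).toFinset ∪ I k W) n
  have hV : ∀ k, V (k + 1) = V k ∪ (Encodable.decode (α := S) k).toFinset ∪ I k (V k) :=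
    fun k => rfl
  refine ⟨V, rfl, monotone_nat_of_le_succ fun k => ?_, fun i => ⟨Encodable.encode i + 1, ?_⟩,
    fun k => ?_⟩
  · rw [hV]
    exact Finset.subset_union_left.trans Finset.subset_union_left
  · rw [hV]
    simp
  · rw [hV]
    exact Finset.subset_union_right

/-- Regrouping a family of local terms `φ k`, living on `supp k`, into a potential. -/
theorem exists_potential_of_local_family {κ E S : Type*} [DecidableEq S]
    (supp : κ → Finset S) (φ : κ → (S → E) → ℝ) (c : κ → ℝ)
    (hc : ∀ k ω, |φ k ω| ≤ c k) (hc0 : ∀ k, 0 ≤ c k)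
    (hloc : ∀ k ω ω', (∀ i ∈ supp k, ω i = ω' i) → φ k ω = φ k ω')
    (hsum : ∀ i, Summable fun k => if i ∈ supp k then c k else 0) :
    ∃ Ψ : Finset S → (S → E) → ℝ,
      (∀ (A : Finset S) (ω σ : S → E), (∀ i ∈ A, ω i = σ i) → Ψ A ω = Ψ A σ) ∧
      (∀ i : S, Summable (fun A : {A : Finset S // i ∈ A} => ⨆ ω : S → E, |Ψ A.1 ω|)) ∧
      ∀ (Λ : Finset S) (ω ω' : S → E), (∀ i ∉ Λ, ω i = ω' i) →
        HasSum (fun k => φ k ω - φ k ω') (hamWith Ψ Λ ω - hamWith Ψ Λ ω') := by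
  refine ⟨fun A ω => ∑' k : {k // supp k = A}, φ k ω, ?_, ?_, ?_⟩
  · intro A ω σ h
    exact tsum_congr fun k => hloc _ _ _ fun i hi => h i (k.2 ▸ hi)
  · intro i
    have hs := (Equiv.sigmaFiberEquiv supp).summable_iff.2 (hsum i)
    refine Summable.of_nonneg_of_le (fun A => Real.iSup_nonneg fun ω => abs_nonneg _) ?_
      (hs.sigma.subtype {A | i ∈ A})
    rintro ⟨A, hA⟩
    have hsA : Summable fun k : {k // supp k = A} => c k :=
      (hs.sigma_factor A).congr fun k => by
        simp only [Function.comp_apply, Equiv.sigmaFiberEquiv_apply]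
        rw [if_pos (by rw [k.2]; exact hA)]
    have htA : (∑' k : {k // supp k = A},
        ((fun k => if i ∈ supp k then c k else 0) ∘ Equiv.sigmaFiberEquiv supp) ⟨A, k⟩) =
          ∑' k : {k // supp k = A}, c k :=
      tsum_congr fun k => by
        simp only [Function.comp_apply, Equiv.sigmaFiberEquiv_apply]
        rw [if_pos (by rw [k.2]; exact hA)]
    simp only [Function.comp_apply] at htA ⊢
    rw [htA]
    refine Real.iSup_le (fun ω => ?_) (tsum_nonneg fun k => hc0 k)
    exact tsum_of_norm_bounded (f := fun k : {k // supp k = A} => φ k ω) hsA.hasSum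
      fun k => hc k ω
  · intro Λ ω ω' hωω'
    have key : ∀ η : S → E, HasSum (fun k => if (supp k ∩ Λ).Nonempty then φ k η else 0)
        (hamWith (fun A ω => ∑' k : {k // supp k = A}, φ k ω) Λ η) := by
      intro η
      have hsm : Summable (fun k => if (supp k ∩ Λ).Nonempty then φ k η else 0) := by
        refine Summable.of_norm_bounded (summable_sum fun i (_ : i ∈ Λ) => hsum i) fun k => ?_
        have hnn : ∀ i ∈ Λ, 0 ≤ if i ∈ supp k then c k else 0 := fun i _ => by
          split_ifs
          exacts [hc0 k, le_rfl]
        split_ifs with hk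
        · obtain ⟨i, hi⟩ := hk
          rw [Finset.mem_inter] at hi
          refine le_trans ?_ (Finset.single_le_sum hnn hi.2)
          rw [if_pos hi.1]
          exact hc k η
        · rw [norm_zero]
          exact Finset.sum_nonneg hnn
      have hs := (Equiv.sigmaFiberEquiv supp).summable_iff.2 hsm
      convert hsm.hasSum using 1
      rw [← (Equiv.sigmaFiberEquiv supp).tsum_eq, hamWith]
      refine (tsum_subtype {A : Finset S | (A ∩ Λ).Nonempty}
        fun A => ∑' k : {k // supp k = A}, φ k η).trans
          (Eq.trans (tsum_congr fun A => ?_) hs.tsum_sigma.symm)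
      by_cases hA : (A ∩ Λ).Nonempty
      · rw [Set.indicator_of_mem (by exact hA)]
        refine tsum_congr fun k => ?_
        simp only [Function.comp_apply, Equiv.sigmaFiberEquiv_apply]
        rw [if_pos (by rw [k.2]; exact hA)]
      · rw [Set.indicator_of_notMem (by exact hA)]
        refine Eq.trans tsum_zero.symm (tsum_congr fun k => ?_)
        simp only [Function.comp_apply, Equiv.sigmaFiberEquiv_apply]
        rw [if_neg (by rw [k.2]; exact hA)]
    refine ((key ω).sub (key ω')).congr_fun fun k => ?_
    split_ifs with hk
    · rfl
    · rw [hloc k ω ω' fun i hi => hωω' i fun hiΛ => hk ⟨i, Finset.mem_inter.2 ⟨hi, hiΛ⟩⟩]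
      simp

/-- A consistent family of continuous finite-volume energies is represented, up to boundary terms,
by a uniformly absolutely convergent potential. -/
theorem exists_potential_of_consistent_energies {E S : Type*} [Finite E] [Nonempty E]
    [TopologicalSpace E] [DiscreteTopology E] [DecidableEq S] [Countable S]
    (h : Finset S → (S → E) → ℝ) (hcont : ∀ Λ, Continuous (h Λ))
    (hcons : ∀ Λ Λ' : Finset S, Λ ⊆ Λ' → ∀ ω ω' : S → E, (∀ i ∉ Λ, ω i = ω' i) →
      h Λ' ω - h Λ' ω' = h Λ ω - h Λ ω') :
    ∃ Ψ : Finset S → (S → E) → ℝ,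
      (∀ (A : Finset S) (ω σ : S → E), (∀ i ∈ A, ω i = σ i) → Ψ A ω = Ψ A σ) ∧
      (∀ i : S, Summable (fun A : {A : Finset S // i ∈ A} => ⨆ ω : S → E, |Ψ A.1 ω|)) ∧
      ∀ (Λ : Finset S) (ω ω' : S → E), (∀ i ∉ Λ, ω i = ω' i) →
        hamWith Ψ Λ ω - hamWith Ψ Λ ω' = h Λ ω - h Λ ω' := by
  obtain ⟨a⟩ : Nonempty (S → E) := inferInstance
  have hhalf : ∀ k : ℕ, (0 : ℝ) < (1 / 2) ^ k := fun k => by positivity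
  choose I hI using fun (k : ℕ) (Λ : Finset S) =>
    exists_finset_abs_sub_lt_of_continuous (hcont Λ) (hhalf k)
  obtain ⟨V, hV0, hVmono, hVex, hVI⟩ := exists_finset_exhaustion I
  have hosc : ∀ k (η η' : S → E), (∀ i ∈ V (k + 1), η i = η' i) →
      |h (V k) η - h (V k) η'| < (1 / 2) ^ k := fun k η η' hη =>
    hI k (V k) η η' fun i hi => hη i (hVI k hi)
  have hbdd : ∀ Λ, ∃ C, ∀ ω, |h Λ ω| ≤ C := fun Λ => by
    obtain ⟨C, hC⟩ := isCompact_univ.exists_bound_of_continuousOn (hcont Λ).continuousOn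
    exact ⟨C, fun ω => hC ω (Set.mem_univ ω)⟩
  choose C hC using hbdd
  have hC0 : ∀ Λ, 0 ≤ C Λ := fun Λ => (abs_nonneg _).trans (hC Λ a)
  -- the energy of `ω` inside `V k`, with the vacuum `a` outside
  let u : ℕ → (S → E) → ℝ := fun k ω => h (V k) ((V k).piecewise ω a)
  have hu_loc : ∀ k (ω ω' : S → E), (∀ i ∈ V k, ω i = ω' i) → u k ω = u k ω' :=
    fun k ω ω' hω => by
      have : (V k).piecewise ω a = (V k).piecewise ω' a := by
        ext i
        by_cases hi : i ∈ V k <;> simp [hi, hω]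
      simp only [u, this]
  have hu_diff : ∀ (Λ : Finset S) k, Λ ⊆ V k → ∀ ω ω' : S → E, (∀ i ∉ Λ, ω i = ω' i) →
      u k ω - u k ω' = h Λ ((V k).piecewise ω a) - h Λ ((V k).piecewise ω' a) :=
    fun Λ k hΛ ω ω' hω => hcons Λ (V k) hΛ _ _ fun i hi => by
      by_cases hiV : i ∈ V k <;> simp [hiV, hω i hi]
  let G : ℕ → (S → E) → ℝ := fun k ω => u (k + 1) ω - u k ω
  let P : ℕ → (S → E) → (S → E) := fun k ω => (V (k - 1)).piecewise a ω
  have hG_loc : ∀ k (ω ω' : S → E), (∀ i ∈ V (k + 1), ω i = ω' i) → G k ω = G k ω' :=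
    fun k ω ω' hω => by
      simp only [G]
      rw [hu_loc (k + 1) ω ω' hω, hu_loc k ω ω' fun i hi => hω i (hVmono k.le_succ hi)]
  have hG_bdd : ∀ k ω, |G k ω| ≤ C (V (k + 1)) + C (V k) := fun k ω =>
    (abs_sub _ _).trans (add_le_add (hC _ _) (hC _ _))
  have hR_bdd : ∀ k ω, |G k ω - G k (P k ω)| ≤ 4 * (1 / 2) ^ k := by
    rintro (_ | j) ω
    · have hP : P 0 ω = ω := by
        ext i
        simp [P, hV0]
      simp [hP]
    · have hoff : ∀ i ∉ V j, ω i = P (j + 1) ω i := fun i hi => by simp [P, hi]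
      have h1 := hu_diff (V j) (j + 1) (hVmono (by omega)) ω _ hoff
      have h2 := hu_diff (V j) (j + 1 + 1) (hVmono (by omega)) ω _ hoff
      have htr : ∀ η : S → E, |h (V j) ((V (j + 1 + 1)).piecewise η a) -
          h (V j) ((V (j + 1)).piecewise η a)| < (1 / 2) ^ j := fun η =>
        hosc j _ _ fun i hi => by simp [hi, hVmono (Nat.le_succ (j + 1)) hi]
      have h3 := abs_lt.1 (htr ω)
      have h4 := abs_lt.1 (htr (P (j + 1) ω))
      rw [pow_succ, abs_le]
      simp only [G]
      constructor <;> linarith [h3.1, h3.2, h4.1, h4.2]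
  obtain ⟨Ψ, hΨloc, hΨsum, hΨham⟩ := exists_potential_of_local_family (κ := ℕ × Bool)
    (fun k => if k.2 then V (k.1 + 1) else V (k.1 + 1) \ V (k.1 - 1))
    (fun k ω => if k.2 then G k.1 ω - G k.1 (P k.1 ω) else G k.1 (P k.1 ω))
    (fun k => if k.2 then 4 * (1 / 2) ^ k.1 else C (V (k.1 + 1)) + C (V k.1))
    (by
      rintro ⟨k, _ | _⟩ ω
      · simpa using hG_bdd k (P k ω)
      · simpa using hR_bdd k ω)
    (by
      rintro ⟨k, _ | _⟩
      · simpa using add_nonneg (hC0 _) (hC0 _)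
      · simp)
    (by
      rintro ⟨k, _ | _⟩ ω ω' hω
      · simp only [Bool.false_eq_true, if_false, Finset.mem_sdiff] at hω ⊢
        refine hG_loc k _ _ fun i hi => ?_
        by_cases hi' : i ∈ V (k - 1)
        · simp [P, hi']
        · simp [P, hi', hω i ⟨hi, hi'⟩]
      · simp only [if_true] at hω ⊢
        rw [hG_loc k ω ω' hω, hG_loc k (P k ω) (P k ω') fun i hi => ?_]
        by_cases hi' : i ∈ V (k - 1) <;> simp [P, hi', hω i hi])
    (by
      intro i
      obtain ⟨N, hN⟩ := hVex i
      refine Summable.of_nonneg_of_le (f := fun k : ℕ × Bool =>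
        if k.2 then 4 * (1 / 2) ^ k.1 else if k.1 ≤ N then C (V (k.1 + 1)) + C (V k.1) else 0)
        ?_ ?_ ?_
      · rintro ⟨k, _ | _⟩
        · simp only [Bool.false_eq_true, if_false]
          split_ifs
          exacts [add_nonneg (hC0 _) (hC0 _), le_rfl]
        · simp only [if_true]
          split_ifs <;> positivity
      · rintro ⟨k, _ | _⟩
        · simp only [Bool.false_eq_true, if_false, Finset.mem_sdiff]
          by_cases hk : k ≤ N
          · rw [if_pos hk]
            split_ifs
            exacts [le_rfl, add_nonneg (hC0 _) (hC0 _)]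
          · rw [if_neg hk, if_neg fun hi => hi.2 (hVmono (by omega) hN)]
        · simp only [if_true]
          split_ifs
          · exact le_rfl
          · positivity
      · rw [summable_prod_of_nonneg]
        · refine ⟨fun k => Summable.of_finite, ?_⟩
          simp only [tsum_fintype, Fintype.sum_bool, if_true, Bool.false_eq_true, if_false]
          refine Summable.add ?_ ?_
          · exact (summable_geometric_of_lt_one (by norm_num) (by norm_num)).mul_left 4
          · refine summable_of_ne_finset_zero (s := Finset.range (N + 1)) fun k hk => ?_
            rw [Finset.mem_range] at hk
            rw [if_neg (by omega)]
        · rintro ⟨k, _ | _⟩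
          · simp only [Bool.false_eq_true, if_false, Pi.zero_apply]
            split_ifs
            exacts [add_nonneg (hC0 _) (hC0 _), le_rfl]
          · simp)
  refine ⟨Ψ, hΨloc, hΨsum, fun Λ ω ω' hω => ?_⟩
  have hG : HasSum (fun k => G k ω - G k ω') (hamWith Ψ Λ ω - hamWith Ψ Λ ω') := by
    refine (hΨham Λ ω ω' hω).prod_fiberwise fun k => ?_
    convert hasSum_fintype (α := ℝ) (β := Bool) _ using 1
    simp
  have hu0 : u 0 ω = u 0 ω' := hu_loc 0 _ _ (by simp [hV0])
  have hlim : Filter.Tendsto (fun n => u n ω - u n ω') Filter.atTop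
      (nhds (hamWith Ψ Λ ω - hamWith Ψ Λ ω')) := by
    refine hG.tendsto_sum_nat.congr fun n => ?_
    rw [Finset.sum_sub_distrib, Finset.sum_range_sub (fun k => u k ω),
      Finset.sum_range_sub (fun k => u k ω'), hu0]
    ring
  have htr : ∀ η : S → E, Filter.Tendsto (fun n => (V n).piecewise η a) Filter.atTop (nhds η) :=
    fun η => tendsto_pi_nhds.2 fun i => by
      obtain ⟨N, hN⟩ := hVex i
      refine tendsto_const_nhds.congr' ?_
      filter_upwards [Filter.eventually_ge_atTop N] with n hn
      simp [hVmono hn hN]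
  have hev : ∀ᶠ n in Filter.atTop, Λ ⊆ V n := by
    have : ∀ᶠ n in Filter.atTop, ∀ i ∈ Λ, i ∈ V n := by
      rw [Filter.eventually_all_finset]
      intro i _
      obtain ⟨N, hN⟩ := hVex i
      filter_upwards [Filter.eventually_ge_atTop N] with n hn
      exact hVmono hn hN
    exact this
  refine tendsto_nhds_unique hlim (Filter.Tendsto.congr' ?_
    ((((hcont Λ).tendsto ω).comp (htr ω)).sub (((hcont Λ).tendsto ω').comp (htr ω'))))
  filter_upwards [hev] with n hn
  exact (hu_diff Λ n hn ω ω' hω).symm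

/-- The diagonal of a kernel that is local in `σ` and continuous in `ω` is continuous. -/
theorem continuous_diag_of_local {E S : Type*} [TopologicalSpace E] [DiscreteTopology E]
    (Λ : Finset S) (g : (S → E) → (S → E) → ℝ)
    (hloc : ∀ σ σ' ω : S → E, (∀ i ∈ Λ, σ i = σ' i) → g σ ω = g σ' ω)
    (hcont : ∀ σ, Continuous (g σ)) : Continuous fun ω => g ω ω := by
  refine continuous_iff_continuousAt.2 fun ω₀ => (hcont ω₀).continuousAt.congr ?_
  have : ∀ᶠ ω in nhds ω₀, ∀ i ∈ Λ, ω i = ω₀ i := by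
    rw [Filter.eventually_all_finset]
    intro i _
    exact ((isOpen_discrete {ω₀ i}).preimage (continuous_apply (A := fun _ : S => E) i)).mem_nhds rfl
  filter_upwards [this] with ω hω
  exact (hloc ω ω₀ ω hω).symm

/-- Gibbs representation theorem (Kozlov): every probability measure `μ` on
`Ω = E^S` (`E` finite, `S` countable) that is quasilocal and uniformly
non-null is a Gibbs measure: there exists a uniformly absolutely convergent
potential `Ψ` with `μ ∈ 𝒢(γ^Ψ)`. Here a quasilocal, uniformly non-null
`μ` is a measure consistent with some specification (described via its
single-configuration weights `γ_Λ(σ|ω)`, with locality/properness,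
normalization, consistency of the densities, continuity in the boundary
condition, and weights uniformly comparable to the uniform product measure
`ρ`, i.e. `α_Λ ρ(A) ≤ γ_Λ(A|ω) ≤ β_Λ ρ(A)`). -/
theorem gibbs_representation_theorem
    {E S : Type*} [Fintype E] [Nonempty E] [MeasurableSpace E]
    [TopologicalSpace E] [DiscreteTopology E] [DecidableEq S] [Countable S]
    (μ : Measure (S → E)) [IsProbabilityMeasure μ]
    (γ : Finset S → (S → E) → (S → E) → ℝ)
    (hdepσ : ∀ (Λ : Finset S) (σ σ2 ω : S → E), (∀ i ∈ Λ, σ i = σ2 i) →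
      γ Λ σ ω = γ Λ σ2 ω)
    (hdepω : ∀ (Λ : Finset S) (σ ω ω2 : S → E), (∀ i ∉ Λ, ω i = ω2 i) →
      γ Λ σ ω = γ Λ σ ω2)
    (hnorm : ∀ (Λ : Finset S) (ω : S → E),
      ∑ σ : ↥Λ → E, γ Λ (extendIn Λ σ ω) ω = 1)
    (hcons : ∀ (Λ Λ2 : Finset S), Λ ⊆ Λ2 → ∀ ω ω2 : S → E,
      (∀ i ∉ Λ, ω i = ω2 i) →
        γ Λ2 ω2 ω2 * γ Λ ω ω = γ Λ ω2 ω2 * γ Λ2 ω ω)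
    (hql : ∀ (Λ : Finset S) (σ : S → E), Continuous (fun ω : S → E => γ Λ σ ω))
    (hnonnull : ∀ Λ : Finset S, ∃ a b : ℝ, 0 < a ∧ a ≤ b ∧
      ∀ σ ω : S → E,
        a / (Fintype.card E : ℝ) ^ Λ.card ≤ γ Λ σ ω ∧
          γ Λ σ ω ≤ b / (Fintype.card E : ℝ) ^ Λ.card)
    (hμ : ∀ (Λ : Finset S) (A : Set (S → E)), MeasurableSet A →
      ∫ ω, (∑ σ : ↥Λ → E,
          Set.indicator A (fun _ => (1 : ℝ)) (extendIn Λ σ ω) *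
            γ Λ (extendIn Λ σ ω) ω) ∂μ = (μ A).toReal) :
    ∃ Ψ : Finset S → (S → E) → ℝ,
      (∀ (A : Finset S) (ω σ : S → E), (∀ i ∈ A, ω i = σ i) → Ψ A ω = Ψ A σ) ∧
      (∀ i : S,
        Summable (fun A : {A : Finset S // i ∈ A} => ⨆ ω : S → E, |Ψ A.1 ω|)) ∧
      (∀ (Λ : Finset S) (A : Set (S → E)), MeasurableSet A →
        ∫ ω, gibbsKernelSet 1 Ψ Λ A ω ∂μ = (μ A).toReal) := by
  have hpos : ∀ (Λ : Finset S) (σ ω : S → E), 0 < γ Λ σ ω := fun Λ σ ω => by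
    obtain ⟨a, b, ha, -, hab⟩ := hnonnull Λ
    exact lt_of_lt_of_le (by positivity) (hab σ ω).1
  obtain ⟨Ψ, hloc, hsum, hham⟩ := exists_potential_of_consistent_energies
    (fun Λ ω => -Real.log (γ Λ ω ω))
    (fun Λ => ((continuous_diag_of_local Λ (γ Λ) (hdepσ Λ) (hql Λ)).log
      fun ω => (hpos Λ ω ω).ne').neg)
    (fun Λ Λ' hΛ ω ω' hω => by
      have := congrArg Real.log (hcons Λ Λ' hΛ ω ω' hω)
      rw [Real.log_mul (hpos _ _ _).ne' (hpos _ _ _).ne',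
        Real.log_mul (hpos _ _ _).ne' (hpos _ _ _).ne'] at this
      linarith)
  refine ⟨Ψ, hloc, hsum, fun Λ A hA => ?_⟩
  rw [← hμ Λ A hA]
  congr 1
  ext ω
  have hext : ∀ σ : ↥Λ → E, ∀ i ∉ Λ, extendIn Λ σ ω i = ω i := fun σ i hi => by
    simp [extendIn, hi]
  have hexp : ∀ σ : ↥Λ → E, Real.exp (-1 * hamWith Ψ Λ (extendIn Λ σ ω)) =
      γ Λ (extendIn Λ σ ω) ω * Real.exp (-Real.log (γ Λ ω ω) - hamWith Ψ Λ ω) := fun σ => by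
    have h := hham Λ (extendIn Λ σ ω) ω (hext σ)
    rw [hdepω Λ _ ω (extendIn Λ σ ω) fun i hi => (hext σ i hi).symm,
      ← Real.exp_log (hpos Λ (extendIn Λ σ ω) (extendIn Λ σ ω)), ← Real.exp_add]
    congr 1
    linarith
  rw [gibbsKernelSet, gibbsKernelFn]
  simp only [hexp, ← mul_assoc]
  rw [← Finset.sum_mul, ← Finset.sum_mul, hnorm, one_mul,
    mul_div_cancel_right₀ _ (Real.exp_pos _).ne']
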